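/- Let q be a Boolean conjunctive query without self-join. If q is safe, then CERTAINTY(q) is first-order expressible. -/

import Mathlib

attribute [local instance] Classical.propDecidable

noncomputable section

/-- A term is either a variable (`Sum.inl v`) or a constant (`Sum.inr c`),
variables and constants both being coded by natural numbers
(the two copies of `ℕ` are disjoint). -/
abbrev Trm := ℕ ⊕ ℕ

/-- A database schema assigns to every relation name (a natural number) an
arity `n` and a primary-key length `k` with `n ≥ k ≥ 1`; the primary key
consists of the first `k` positions. -/
structure Schema where
  arity : ℕ → ℕ
  keyLen : ℕ → ℕ
  keyLen_le_arity : ∀ R, keyLen R ≤ arity R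
  one_le_keyLen : ∀ R, 1 ≤ keyLen R

/-- An atom: a relation name together with a list of arguments. -/
structure Atom where
  rel : ℕ
  args : List Trm
deriving DecidableEq

/-- Variables occurring in a list of terms. -/
def varsL (l : List Trm) : Finset ℕ := (l.filterMap Sum.getLeft?).toFinset

/-- Constants occurring in a list of terms. -/
def constsL (l : List Trm) : Finset ℕ := (l.filterMap Sum.getRight?).toFinset

/-- All variables of an atom. -/
def varsA (A : Atom) : Finset ℕ := varsL A.args

/-- Key variables of an atom: variables in the primary-key positions. -/
def keyVars (S : Schema) (A : Atom) : Finset ℕ := varsL (A.args.take (S.keyLen A.rel))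

/-- Constants of an atom. -/
def constsA (A : Atom) : Finset ℕ := constsL A.args

/-- Well-formed atom: number of arguments equals the arity of its relation name. -/
def wfAtom (S : Schema) (A : Atom) : Prop := A.args.length = S.arity A.rel

/-- A fact is an atom without variables. -/
def isFact (A : Atom) : Prop := ∀ t ∈ A.args, ∃ c : ℕ, t = Sum.inr c

/-- Two (facts) are key-equal: same relation name, and same primary-key positions. -/
def keyEqual (S : Schema) (A B : Atom) : Prop :=
  A.rel = B.rel ∧ A.args.take (S.keyLen A.rel) = B.args.take (S.keyLen B.rel)

/-- The block of `A` in `db`: all facts of `db` key-equal to `A`. -/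
def block (S : Schema) (A : Atom) (db : Finset Atom) : Finset Atom :=
  db.filter (fun B => keyEqual S A B)

/-- An uncertain database: a finite set of well-formed facts. -/
def IsDb (S : Schema) (db : Finset Atom) : Prop := ∀ A ∈ db, isFact A ∧ wfAtom S A

/-- A set of facts is consistent if it contains no two distinct key-equal facts. -/
def Consistent (S : Schema) (db : Finset Atom) : Prop :=
  ∀ A ∈ db, ∀ B ∈ db, keyEqual S A B → A = B

/-- A repair of `db`: a maximal consistent subset of `db`. -/
def IsRepair (S : Schema) (db r : Finset Atom) : Prop :=
  r ⊆ db ∧ Consistent S r ∧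
    ∀ r' : Finset Atom, r ⊆ r' → r' ⊆ db → Consistent S r' → r' = r

/-- Applying a valuation (a total map from variables to constants) to a term. -/
def appT (θ : ℕ → ℕ) : Trm → Trm
  | Sum.inl v => Sum.inr (θ v)
  | Sum.inr c => Sum.inr c

/-- Applying a valuation to an atom. -/
def appA (θ : ℕ → ℕ) (A : Atom) : Atom := ⟨A.rel, A.args.map (appT θ)⟩

/-- Applying a valuation to a query. -/
def appQ (θ : ℕ → ℕ) (q : Finset Atom) : Finset Atom := q.image (appA θ)

/-- `db ⊨ q`: some valuation sends every atom of `q` into `db`. -/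
def Sat (db q : Finset Atom) : Prop := ∃ θ : ℕ → ℕ, appQ θ q ⊆ db

/-- `db ∈ CERTAINTY(q)`: every repair of `db` satisfies `q`. -/
def Certainty (S : Schema) (q db : Finset Atom) : Prop :=
  ∀ r : Finset Atom, IsRepair S db r → Sat r q

/-- Variables of a query. -/
def varsQ (q : Finset Atom) : Finset ℕ := q.biUnion varsA

/-- Constants of a query. -/
def constsQ (q : Finset Atom) : Finset ℕ := q.biUnion constsA

/-- `q` has no self-join: no two distinct atoms share a relation name. -/
def NoSelfJoin (q : Finset Atom) : Prop := ∀ F ∈ q, ∀ G ∈ q, F.rel = G.rel → F = G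

/-- `db` is purified relative to `q`. -/
def Purified (q db : Finset Atom) : Prop :=
  ∀ A ∈ db, ∃ θ : ℕ → ℕ, A ∈ appQ θ q ∧ appQ θ q ⊆ db

/-- Active domain of a database: all constants occurring in its facts. -/
def adom (db : Finset Atom) : Finset ℕ := db.biUnion constsA

/-- Membership in the attribute closure of `X` under a set `FDs` of
functional dependencies (standard implication of functional dependencies). -/
inductive InCl (FDs : Set (Finset ℕ × Finset ℕ)) (X : Finset ℕ) : ℕ → Prop
  | base {x : ℕ} : x ∈ X → InCl FDs X x
  | step {Z W : Finset ℕ} {w : ℕ} : (Z, W) ∈ FDs → (∀ z ∈ Z, InCl FDs X z) →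
      w ∈ W → InCl FDs X w

/-- `FDs ⊨ X → Y`. -/
def FDImp (FDs : Set (Finset ℕ × Finset ℕ)) (X Y : Finset ℕ) : Prop :=
  ∀ y ∈ Y, InCl FDs X y

/-- `FD(q) = { key(F) → vars(F) : F ∈ q }`. -/
def FDq (S : Schema) (q : Finset Atom) : Set (Finset ℕ × Finset ℕ) :=
  {p | ∃ F ∈ q, p = (keyVars S F, varsA F)}

/-- `F^{+,q} = {x ∈ vars(q) : FD(q \ {F}) ⊨ key(F) → x}`. -/
def plusCl (S : Schema) (q : Finset Atom) (F : Atom) : Set ℕ :=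
  {x | x ∈ varsQ q ∧ InCl (FDq S (q.erase F)) (keyVars S F) x}

/-- `F^{⊕,q} = {x ∈ vars(q) : FD(q) ⊨ key(F) → x}`. -/
def oplusCl (S : Schema) (q : Finset Atom) (F : Atom) : Set ℕ :=
  {x | x ∈ varsQ q ∧ InCl (FDq S q) (keyVars S F) x}

/-- A (simple) path in an undirected graph given by edge relation `E`. -/
def IsPath (E : Atom → Atom → Prop) (p : List Atom) : Prop :=
  p ≠ [] ∧ p.Nodup ∧ List.Chain' E p

/-- `E` is (the edge relation of) a join tree for `q`: a tree (unique simple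
paths between any two vertices) on the atoms of `q` satisfying the
Connectedness Condition. -/
def IsJoinTree (q : Finset Atom) (E : Atom → Atom → Prop) : Prop :=
  (∀ a b, E a b → E b a) ∧
  (∀ a b, E a b → a ∈ q ∧ b ∈ q ∧ a ≠ b) ∧
  (∀ a ∈ q, ∀ b ∈ q, ∃! p : List Atom,
      IsPath E p ∧ p.head? = some a ∧ p.getLast? = some b) ∧
  (∀ x : ℕ, ∀ F ∈ q, ∀ G ∈ q, x ∈ varsA F → x ∈ varsA G →
      ∀ p : List Atom, IsPath E p → p.head? = some F → p.getLast? = some G →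
        ∀ H ∈ p, x ∈ varsA H)

/-- The consecutive pairs (edges) of a path. -/
def edgePairs (p : List Atom) : List (Atom × Atom) := p.zip p.tail

/-- `F ↝ G` in the attack graph of the join tree `E` of `q`: `F ≠ G` are atoms
of `q`, and no label `vars(H) ∩ vars(H')` of an edge on the (unique) path from
`F` to `G` is contained in `F^{+,q}`. -/
def Attacks (S : Schema) (q : Finset Atom) (E : Atom → Atom → Prop) (F G : Atom) : Prop :=
  F ∈ q ∧ G ∈ q ∧ F ≠ G ∧
  ∀ p : List Atom, IsPath E p → p.head? = some F → p.getLast? = some G →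
    ∀ e ∈ edgePairs p, ¬ ((↑(varsA e.1 ∩ varsA e.2) : Set ℕ) ⊆ plusCl S q F)

/-- The attack `F ↝ G` is weak: `key(G) ⊆ F^{⊕,q}`. -/
def Weak (S : Schema) (q : Finset Atom) (F G : Atom) : Prop :=
  (↑(keyVars S G) : Set ℕ) ⊆ oplusCl S q F

/-- Consecutive pairs of a cyclic sequence, including the wrap-around pair. -/
def cyclePairs (L : List Atom) : List (Atom × Atom) := L.zip (L.rotate 1)

/-- `L` is an (elementary directed) cycle in the directed graph `att`. -/
def IsCycle (att : Atom → Atom → Prop) (L : List Atom) : Prop :=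
  2 ≤ L.length ∧ L.Nodup ∧ ∀ e ∈ cyclePairs L, att e.1 e.2

/-- A cycle is terminal: no edge leads from a vertex in the cycle to a vertex
outside the cycle. -/
def TerminalCycle (att : Atom → Atom → Prop) (L : List Atom) : Prop :=
  ∀ a ∈ L, ∀ b, att a b → b ∈ L

/-- A strong cycle in the attack graph: a cycle at least one attack of which is strong. -/
def StrongCycle (S : Schema) (q : Finset Atom) (E : Atom → Atom → Prop)
    (L : List Atom) : Prop :=
  IsCycle (Attacks S q E) L ∧ ∃ e ∈ cyclePairs L, ¬ Weak S q e.1 e.2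

/-- Substituting constant `c` for variable `z` in a term. -/
def substT (z c : ℕ) : Trm → Trm
  | Sum.inl v => if v = z then Sum.inr c else Sum.inl v
  | Sum.inr d => Sum.inr d

/-- `F[z→c]`. -/
def substA (z c : ℕ) (A : Atom) : Atom := ⟨A.rel, A.args.map (substT z c)⟩

/-- `q[z→c]`. -/
def substQ (z c : ℕ) (q : Finset Atom) : Finset Atom := q.image (substA z c)

/-- Simultaneous substitution of the constants `bs` for the (distinct)
variables `xs` (componentwise) in a term. -/
def substLT (xs bs : List ℕ) : Trm → Trm
  | Sum.inl v => if v ∈ xs then Sum.inr (bs.getD (xs.idxOf v) 0) else Sum.inl v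
  | Sum.inr d => Sum.inr d

/-- `F[x⃗→b⃗]`. -/
def substLA (xs bs : List ℕ) (A : Atom) : Atom := ⟨A.rel, A.args.map (substLT xs bs)⟩

/-- `q[x⃗→b⃗]`. -/
def substLQ (xs bs : List ℕ) (q : Finset Atom) : Finset Atom := q.image (substLA xs bs)

/-- First-order formulas over the relational vocabulary (relation names and
constants coded by naturals, variables coded by naturals). -/
inductive Fml where
  | atom (R : ℕ) (args : List Trm)
  | eq (s t : Trm)
  | tru
  | not (φ : Fml)
  | and (φ ψ : Fml)
  | or (φ ψ : Fml)
  | ex (v : ℕ) (φ : Fml)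
  | all (v : ℕ) (φ : Fml)

/-- Value of a term under an assignment of constants to variables. -/
def evalT (σ : ℕ → ℕ) : Trm → ℕ
  | Sum.inl v => σ v
  | Sum.inr c => c

/-- Satisfaction of a first-order formula in the finite structure whose
relations are given by the facts of `db`, with quantifiers ranging over `dom`. -/
def Holds (db : Finset Atom) (dom : Finset ℕ) : Fml → (ℕ → ℕ) → Prop
  | .atom R args, σ => (⟨R, args.map fun t => Sum.inr (evalT σ t)⟩ : Atom) ∈ db
  | .eq s t, σ => evalT σ s = evalT σ t
  | .tru, _ => True
  | .not φ, σ => ¬ Holds db dom φ σ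
  | .and φ ψ, σ => Holds db dom φ σ ∧ Holds db dom ψ σ
  | .or φ ψ, σ => Holds db dom φ σ ∨ Holds db dom ψ σ
  | .ex v φ, σ => ∃ a ∈ dom, Holds db dom φ (Function.update σ v a)
  | .all v φ, σ => ∀ a ∈ dom, Holds db dom φ (Function.update σ v a)

/-- Free variables of a formula. -/
def Fml.free : Fml → Finset ℕ
  | .atom _ args => varsL args
  | .eq s t => varsL [s, t]
  | .tru => ∅
  | .not φ => φ.free
  | .and φ ψ => φ.free ∪ ψ.free
  | .or φ ψ => φ.free ∪ ψ.free
  | .ex v φ => φ.free.erase v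
  | .all v φ => φ.free.erase v

/-- Relation names occurring in a formula. -/
def Fml.rels : Fml → Finset ℕ
  | .atom R _ => {R}
  | .eq _ _ => ∅
  | .tru => ∅
  | .not φ => φ.rels
  | .and φ ψ => φ.rels ∪ ψ.rels
  | .or φ ψ => φ.rels ∪ ψ.rels
  | .ex _ φ => φ.rels
  | .all _ φ => φ.rels

/-- Constants occurring in a formula. -/
def Fml.consts : Fml → Finset ℕ
  | .atom _ args => constsL args
  | .eq s t => constsL [s, t]
  | .tru => ∅
  | .not φ => φ.consts
  | .and φ ψ => φ.consts ∪ ψ.consts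
  | .or φ ψ => φ.consts ∪ ψ.consts
  | .ex _ φ => φ.consts
  | .all _ φ => φ.consts

/-- Well-formed formula: every atom has as many arguments as the arity of its
relation name. -/
def FmlWf (S : Schema) : Fml → Prop
  | .atom R args => args.length = S.arity R
  | .eq _ _ => True
  | .tru => True
  | .not φ => FmlWf S φ
  | .and φ ψ => FmlWf S φ ∧ FmlWf S ψ
  | .or φ ψ => FmlWf S φ ∧ FmlWf S ψ
  | .ex _ φ => FmlWf S φ
  | .all _ φ => FmlWf S φ

/-- The safety predicate of Dalvi, Ré and Suciu (rules SE1–SE4). -/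
inductive Safe (S : Schema) : Finset Atom → Prop
  | se1 (A : Atom) : isFact A → Safe S {A}
  | se2 (q₁ q₂ : Finset Atom) : q₁.Nonempty → q₂.Nonempty →
      Disjoint (varsQ q₁) (varsQ q₂) → Safe S q₁ → Safe S q₂ → Safe S (q₁ ∪ q₂)
  | se3 (q : Finset Atom) (x a : ℕ) : (∀ F ∈ q, x ∈ keyVars S F) →
      Safe S (substQ x a q) → Safe S q
  | se4 (q : Finset Atom) (F : Atom) (x a : ℕ) : F ∈ q → keyVars S F = ∅ →
      varsA F ≠ ∅ → x ∈ varsA F → Safe S (substQ x a q) → Safe S q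

/-- The atom `R_i(x_i ; x_{i+1})` (with `x_{k+1} = x_1`) of the query `acq_k`;
variable `x_i` is coded by `i`, relation name `R_i` by `i`. -/
def Ratom (k i : ℕ) : Atom := ⟨i, [Sum.inl i, Sum.inl (i % k + 1)]⟩

/-- The all-key atom `S_k(x_1,…,x_k)` of the query `acq_k`;
relation name `S_k` is coded by `0`. -/
def Satom (k : ℕ) : Atom := ⟨0, (List.range k).map (fun j => Sum.inl (j + 1))⟩

/-- The query `acq_k = {R_1(x_1;x_2), …, R_k(x_k;x_1), S_k(x_1,…,x_k)}`. -/
def acq (k : ℕ) : Finset Atom := ((Finset.Icc 1 k).image (Ratom k)) ∪ {Satom k}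

/-- Sum of `Pr` over the possible (= consistent) worlds of `db` satisfying `P`. -/
def prOf (S : Schema) (db : Finset Atom) (Pr : Finset Atom → ℚ)
    (P : Finset Atom → Prop) : ℚ :=
  ∑ w ∈ db.powerset.filter (fun w => Consistent S w ∧ P w), Pr w

end

section AuxProofs

theorem mem_varsL {l : List Trm} {v : ℕ} : v ∈ varsL l ↔ (Sum.inl v : Trm) ∈ l := by
  simp [varsL]

theorem mem_constsL {l : List Trm} {c : ℕ} : c ∈ constsL l ↔ (Sum.inr c : Trm) ∈ l := by
  simp [constsL]

theorem mem_varsQ {q : Finset Atom} {v : ℕ} : v ∈ varsQ q ↔ ∃ A ∈ q, v ∈ varsA A := by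
  simp [varsQ]

theorem keyVars_subset (S : Schema) (A : Atom) : keyVars S A ⊆ varsA A := by
  intro v hv
  rw [keyVars, mem_varsL] at hv
  rw [varsA, mem_varsL]
  exact List.mem_of_mem_take hv

theorem varsL_subst (x a : ℕ) (l : List Trm) :
    varsL (l.map (substT x a)) = (varsL l).erase x := by
  ext v
  rw [Finset.mem_erase, mem_varsL, mem_varsL, List.mem_map]
  constructor
  · rintro ⟨t, ht, h⟩
    rcases t with w | c
    · simp only [substT] at h
      split_ifs at h with hw
      cases h
      exact ⟨hw, ht⟩
    · simp [substT] at h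
  · rintro ⟨h1, h2⟩
    exact ⟨_, h2, by simp [substT, h1]⟩

theorem varsA_subst (x a : ℕ) (A : Atom) : varsA (substA x a A) = (varsA A).erase x :=
  varsL_subst x a A.args

theorem keyVars_subst (S : Schema) (x a : ℕ) (A : Atom) :
    keyVars S (substA x a A) = (keyVars S A).erase x := by
  simp only [keyVars, substA, ← List.map_take]
  exact varsL_subst x a _

/-- Safety with a set `V` of variables treated as constants (parameters). -/
inductive SafeX (S : Schema) : Finset ℕ → Finset Atom → Prop
  | empty (V : Finset ℕ) : SafeX S V ∅
  | split (V : Finset ℕ) (q₁ q₂ : Finset Atom) :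
      (∀ x ∈ varsQ q₁, x ∈ varsQ q₂ → x ∈ V) →
      SafeX S V q₁ → SafeX S V q₂ → SafeX S V (q₁ ∪ q₂)
  | key (V : Finset ℕ) (q : Finset Atom) (x : ℕ) : x ∉ V → q.Nonempty →
      (∀ F ∈ q, x ∈ keyVars S F) → SafeX S (insert x V) q → SafeX S V q
  | peel (V : Finset ℕ) (q : Finset Atom) (F : Atom) : F ∈ q → keyVars S F ⊆ V →
      SafeX S (V ∪ varsA F) (q.erase F) → SafeX S V q

theorem safeX_ground (S : Schema) (q : Finset Atom) :
    ∀ V : Finset ℕ, (∀ A ∈ q, varsA A ⊆ V) → SafeX S V q := by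
  induction q using Finset.strongInduction with
  | H q ih =>
    intro V h
    rcases q.eq_empty_or_nonempty with rfl | ⟨F, hF⟩
    · exact SafeX.empty V
    · refine SafeX.peel V q F hF ((keyVars_subset S F).trans (h F hF)) ?_
      refine ih _ (Finset.erase_ssubset hF) _ ?_
      intro A hA
      exact (h A (Finset.mem_of_mem_erase hA)).trans Finset.subset_union_left

theorem safe_to_safeX (S : Schema) (p : Finset Atom) (hp : Safe S p) :
    ∀ (V : Finset ℕ) (q : Finset Atom) (f : Atom → Atom),
      (∀ A ∈ q, f A ∈ p) →
      (∀ A ∈ q, ∀ x, x ∉ V → (x ∈ varsA (f A) ↔ x ∈ varsA A)) →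
      (∀ A ∈ q, ∀ x, x ∉ V → (x ∈ keyVars S (f A) ↔ x ∈ keyVars S A)) →
      (∀ B ∈ p, (∃ A ∈ q, f A = B) ∨ varsA B ⊆ V) → SafeX S V q := by
  induction hp with
  | se1 A hA =>
    intro V q f h1 h2 h3 h4
    refine safeX_ground S q V ?_
    intro B hB x hx
    by_contra hxV
    have := (h2 B hB x hxV).2 hx
    rw [Finset.mem_singleton.1 (h1 B hB), varsA, mem_varsL] at this
    obtain ⟨c, hc⟩ := hA _ this
    cases hc
  | se2 q₁ q₂ _ _ hd _ _ ih1 ih2 =>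
    intro V q f h1 h2 h3 h4
    have hq : q = q.filter (fun A => f A ∈ q₁) ∪ q.filter (fun A => f A ∈ q₂) := by
      ext A
      simp only [Finset.mem_union, Finset.mem_filter]
      have := h1 A
      simp only [Finset.mem_union] at this
      tauto
    rw [hq]
    refine SafeX.split V _ _ ?_ ?_ ?_
    · intro x hx1 hx2
      by_contra hxV
      obtain ⟨A, hA, hxA⟩ := mem_varsQ.1 hx1
      obtain ⟨B, hB, hxB⟩ := mem_varsQ.1 hx2
      rw [Finset.mem_filter] at hA hB
      exact Finset.disjoint_left.1 hd (mem_varsQ.2 ⟨_, hA.2, (h2 A hA.1 x hxV).2 hxA⟩)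
        (mem_varsQ.2 ⟨_, hB.2, (h2 B hB.1 x hxV).2 hxB⟩)
    · refine ih1 V _ f ?_ ?_ ?_ ?_
      · intro A hA; exact (Finset.mem_filter.1 hA).2
      · intro A hA; exact h2 A (Finset.mem_filter.1 hA).1
      · intro A hA; exact h3 A (Finset.mem_filter.1 hA).1
      · intro B hB
        rcases h4 B (Finset.mem_union_left _ hB) with ⟨A, hA, rfl⟩ | h
        · exact Or.inl ⟨A, Finset.mem_filter.2 ⟨hA, hB⟩, rfl⟩
        · exact Or.inr h
    · refine ih2 V _ f ?_ ?_ ?_ ?_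
      · intro A hA; exact (Finset.mem_filter.1 hA).2
      · intro A hA; exact h2 A (Finset.mem_filter.1 hA).1
      · intro A hA; exact h3 A (Finset.mem_filter.1 hA).1
      · intro B hB
        rcases h4 B (Finset.mem_union_right _ hB) with ⟨A, hA, rfl⟩ | h
        · exact Or.inl ⟨A, Finset.mem_filter.2 ⟨hA, hB⟩, rfl⟩
        · exact Or.inr h
  | se3 p x a hx _ ih =>
    intro V q f h1 h2 h3 h4
    have main : ∀ W : Finset ℕ, V ⊆ W → x ∈ W → SafeX S W q := by
      intro W hVW hxW
      refine ih W q (fun A => substA x a (f A)) ?_ ?_ ?_ ?_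
      · intro A hA; exact Finset.mem_image_of_mem _ (h1 A hA)
      · intro A hA y hy
        have hyx : y ≠ x := fun h => hy (h ▸ hxW)
        rw [varsA_subst, Finset.mem_erase, h2 A hA y (fun h => hy (hVW h))]
        tauto
      · intro A hA y hy
        have hyx : y ≠ x := fun h => hy (h ▸ hxW)
        rw [keyVars_subst, Finset.mem_erase, h3 A hA y (fun h => hy (hVW h))]
        tauto
      · intro B hB
        obtain ⟨C, hC, rfl⟩ := Finset.mem_image.1 hB
        rcases h4 C hC with ⟨A, hA, rfl⟩ | h
        · exact Or.inl ⟨A, hA, rfl⟩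
        · right
          rw [varsA_subst]
          exact (Finset.erase_subset _ _).trans (h.trans hVW)
    by_cases hxV : x ∈ V
    · exact main V subset_rfl hxV
    · rcases q.eq_empty_or_nonempty with rfl | hne
      · exact SafeX.empty V
      · refine SafeX.key V q x hxV hne ?_
          (main _ (Finset.subset_insert x V) (Finset.mem_insert_self x V))
        intro F hF
        exact (h3 F hF x hxV).1 (hx _ (h1 F hF))
  | se4 p F x a hF hk _ hx _ ih =>
    intro V q f h1 h2 h3 h4
    have main : ∀ (W : Finset ℕ) (q' : Finset Atom), V ⊆ W → x ∈ W → q' ⊆ q →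
        (∀ A ∈ q, A ∉ q' → varsA A ⊆ W) → SafeX S W q' := by
      intro W q' hVW hxW hqq hrem
      refine ih W q' (fun A => substA x a (f A)) ?_ ?_ ?_ ?_
      · intro A hA; exact Finset.mem_image_of_mem _ (h1 A (hqq hA))
      · intro A hA y hy
        have hyx : y ≠ x := fun h => hy (h ▸ hxW)
        rw [varsA_subst, Finset.mem_erase, h2 A (hqq hA) y (fun h => hy (hVW h))]
        tauto
      · intro A hA y hy
        have hyx : y ≠ x := fun h => hy (h ▸ hxW)
        rw [keyVars_subst, Finset.mem_erase, h3 A (hqq hA) y (fun h => hy (hVW h))]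
        tauto
      · intro B hB
        obtain ⟨C, hC, rfl⟩ := Finset.mem_image.1 hB
        rcases h4 C hC with ⟨A, hA, rfl⟩ | h
        · by_cases hAq : A ∈ q'
          · exact Or.inl ⟨A, hAq, rfl⟩
          · right
            rw [varsA_subst]
            intro y hy
            by_contra hyW
            exact hyW (hrem A hA hAq
              ((h2 A hA y (fun h => hyW (hVW h))).1 (Finset.mem_of_mem_erase hy)))
        · right
          rw [varsA_subst]
          exact (Finset.erase_subset _ _).trans (h.trans hVW)
    by_cases hxV : x ∈ V
    · exact main V q subset_rfl hxV subset_rfl (fun A h h' => absurd h h')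
    · rcases h4 F hF with ⟨A, hA, rfl⟩ | h
      · refine SafeX.peel V q A hA ?_ (main _ _ Finset.subset_union_left
          (Finset.mem_union_right _ ((h2 A hA x hxV).1 hx)) (Finset.erase_subset _ _) ?_)
        · intro y hy
          by_contra hyV
          have := (h3 A hA y hyV).2 hy
          rw [hk] at this
          simp at this
        · intro B hB hB'
          have : B = A := by
            by_contra hne
            exact hB' (Finset.mem_erase.2 ⟨hne, hB⟩)
          subst this
          exact Finset.subset_union_right
      · exact absurd (h hx) hxV

theorem safeX_of_safe (S : Schema) (q : Finset Atom) (hq : Safe S q) : SafeX S ∅ q :=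
  safe_to_safeX S q hq ∅ q id (fun _ h => h) (fun _ _ _ _ => Iff.rfl)
    (fun _ _ _ _ => Iff.rfl) (fun B hB => Or.inl ⟨B, hB, rfl⟩)


theorem keyEqual_symm {S : Schema} {A B : Atom} (h : keyEqual S A B) : keyEqual S B A :=
  ⟨h.1.symm, h.2.symm⟩

theorem keyEqual_trans {S : Schema} {A B C : Atom} (h : keyEqual S A B)
    (h' : keyEqual S B C) : keyEqual S A C :=
  ⟨h.1.trans h'.1, h.2.trans h'.2⟩

theorem isRepair_iff (S : Schema) (db r : Finset Atom) :
    IsRepair S db r ↔ r ⊆ db ∧ Consistent S r ∧ ∀ A ∈ db, ∃ B ∈ r, keyEqual S A B := by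
  constructor
  · rintro ⟨h1, h2, h3⟩
    refine ⟨h1, h2, ?_⟩
    intro A hA
    by_contra hno
    push Not at hno
    have := h3 (insert A r) (Finset.subset_insert _ _)
      (Finset.insert_subset hA h1) ?_
    · have hAr : A ∈ r := this ▸ Finset.mem_insert_self A r
      exact hno A hAr ⟨rfl, rfl⟩
    · intro B hB C hC hBC
      rcases Finset.mem_insert.1 hB with hB1 | hB1
      · rcases Finset.mem_insert.1 hC with hC1 | hC1
        · rw [hB1, hC1]
        · exact absurd (hB1 ▸ hBC) (hno C hC1)
      · rcases Finset.mem_insert.1 hC with hC1 | hC1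
        · exact absurd (keyEqual_symm (hC1 ▸ hBC)) (hno B hB1)
        · exact h2 B hB1 C hC1 hBC
  · rintro ⟨h1, h2, h3⟩
    refine ⟨h1, h2, ?_⟩
    intro r' hr hdb hc
    refine Finset.Subset.antisymm ?_ hr
    intro A hA
    obtain ⟨B, hB, hAB⟩ := h3 A (hdb hA)
    rw [hc A hA B (hr hB) hAB]
    exact hB

theorem exists_repair (S : Schema) (db s : Finset Atom) (hs : s ⊆ db)
    (hc : Consistent S s) : ∃ r, IsRepair S db r ∧ s ⊆ r := by
  have hfin : {t : Finset Atom | t ⊆ db ∧ Consistent S t}.Finite :=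
    (Finset.finite_toSet db.powerset).subset (by
      intro t ht
      simpa using ht.1)
  obtain ⟨r, hsr, hr⟩ := hfin.exists_le_maximal (show s ∈ _ from ⟨hs, hc⟩)
  refine ⟨r, ⟨hr.prop.1, hr.prop.2, ?_⟩, hsr⟩
  intro r' h1 h2 h3
  exact Finset.Subset.antisymm (hr.le_of_ge ⟨h2, h3⟩ h1) h1

theorem combine_repair (S : Schema) (db : Finset Atom) (ρ : ℕ → Finset Atom)
    (hρ : ∀ c, IsRepair S db (ρ c)) (κ : Atom → ℕ)
    (hκ : ∀ A B, keyEqual S A B → κ A = κ B) :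
    IsRepair S db (db.filter (fun A => A ∈ ρ (κ A))) := by
  rw [isRepair_iff]
  refine ⟨Finset.filter_subset _ _, ?_, ?_⟩
  · intro A hA B hB hAB
    rw [Finset.mem_filter] at hA hB
    have h := hB.2
    rw [← hκ A B hAB] at h
    exact (hρ _).2.1 A hA.2 B h hAB
  · intro A hA
    obtain ⟨B, hB, hAB⟩ := ((isRepair_iff S db _).1 (hρ (κ A))).2.2 A hA
    refine ⟨B, Finset.mem_filter.2 ⟨(hρ _).1 hB, ?_⟩, hAB⟩
    rw [← hκ A B hAB]
    exact hB


/-- Certainty where the variables in `V` are interpreted by `σ`. -/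
def CertV (S : Schema) (V : Finset ℕ) (q db : Finset Atom) (σ : ℕ → ℕ) : Prop :=
  ∀ r, IsRepair S db r → ∃ θ : ℕ → ℕ, (∀ v ∈ V, θ v = σ v) ∧ ∀ A ∈ q, appA θ A ∈ r

theorem CertV_empty_iff (S : Schema) (q db : Finset Atom) (σ : ℕ → ℕ) :
    Certainty S q db ↔ CertV S ∅ q db σ := by
  simp only [Certainty, CertV, Sat, appQ, Finset.image_subset_iff]
  simp

theorem CertV_congr {S : Schema} {V : Finset ℕ} {q db : Finset Atom} {σ τ : ℕ → ℕ}
    (h : ∀ v ∈ V, σ v = τ v) : CertV S V q db σ ↔ CertV S V q db τ := by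
  unfold CertV
  refine forall_congr' fun r => imp_congr_right fun _ => exists_congr fun θ => ?_
  refine and_congr_left fun _ => forall_congr' fun v => forall_congr' fun hv => ?_
  rw [h v hv]

theorem appL_congr {θ τ : ℕ → ℕ} {l : List Trm} (h : ∀ v ∈ varsL l, θ v = τ v) :
    l.map (appT θ) = l.map (appT τ) := by
  refine List.map_congr_left ?_
  intro t ht
  rcases t with v | c
  · simp [appT, h v (mem_varsL.2 ht)]
  · rfl

theorem appL_eq {θ τ : ℕ → ℕ} {l : List Trm}
    (h : l.map (appT θ) = l.map (appT τ)) : ∀ v ∈ varsL l, θ v = τ v := by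
  intro v hv
  have := (List.map_inj_left.1 h) _ (mem_varsL.1 hv)
  simpa [appT] using this

theorem appA_congr {θ τ : ℕ → ℕ} {A : Atom} (h : ∀ v ∈ varsA A, θ v = τ v) :
    appA θ A = appA τ A := by
  simp only [appA, appL_congr h]

theorem appA_eq {θ τ : ℕ → ℕ} {A : Atom} (h : appA θ A = appA τ A) :
    ∀ v ∈ varsA A, θ v = τ v := by
  simp only [appA, Atom.mk.injEq, true_and] at h
  exact appL_eq h

theorem CertV_split (S : Schema) (V : Finset ℕ) (q₁ q₂ db : Finset Atom) (σ : ℕ → ℕ)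
    (hd : ∀ x ∈ varsQ q₁, x ∈ varsQ q₂ → x ∈ V) :
    CertV S V (q₁ ∪ q₂) db σ ↔ CertV S V q₁ db σ ∧ CertV S V q₂ db σ := by
  constructor
  · intro h
    constructor
    · intro r hr
      obtain ⟨θ, h1, h2⟩ := h r hr
      exact ⟨θ, h1, fun A hA => h2 A (Finset.mem_union_left _ hA)⟩
    · intro r hr
      obtain ⟨θ, h1, h2⟩ := h r hr
      exact ⟨θ, h1, fun A hA => h2 A (Finset.mem_union_right _ hA)⟩
  · rintro ⟨ha, hb⟩ r hr
    obtain ⟨θ, h1, h2⟩ := ha r hr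
    obtain ⟨τ, h3, h4⟩ := hb r hr
    refine ⟨fun v => if v ∈ varsQ q₁ then θ v else τ v, ?_, ?_⟩
    · intro v hv
      simp only
      split_ifs
      · exact h1 v hv
      · exact h3 v hv
    · intro A hA
      rcases Finset.mem_union.1 hA with hA | hA
      · rw [appA_congr (τ := θ)]
        · exact h2 A hA
        · intro v hv
          rw [if_pos (mem_varsQ.2 ⟨A, hA, hv⟩)]
      · rw [appA_congr (τ := τ)]
        · exact h4 A hA
        · intro v hv
          split_ifs with hv1
          · have := hd v hv1 (mem_varsQ.2 ⟨A, hA, hv⟩)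
            rw [h1 v this, h3 v this]
          · rfl

theorem mem_adom_of_app {db : Finset Atom} {θ : ℕ → ℕ} {A : Atom} (h : appA θ A ∈ db)
    {v : ℕ} (hv : v ∈ varsA A) : θ v ∈ adom db := by
  rw [adom, Finset.mem_biUnion]
  refine ⟨_, h, ?_⟩
  rw [constsA, mem_constsL]
  exact List.mem_map.2 ⟨_, mem_varsL.1 hv, rfl⟩

theorem CertV_key (S : Schema) (V : Finset ℕ) (q db : Finset Atom) (σ : ℕ → ℕ) (x : ℕ)
    (hxV : x ∉ V) (hne : q.Nonempty) (hx : ∀ F ∈ q, x ∈ keyVars S F) (hn : NoSelfJoin q)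
    (D : Finset ℕ) (hD : adom db ⊆ D) :
    CertV S V q db σ ↔ ∃ a ∈ D, CertV S (insert x V) q db (Function.update σ x a) := by
  constructor
  · intro h
    by_contra hno
    have hno' : ∀ c, ∃ r, IsRepair S db r ∧ ∀ θ : ℕ → ℕ, (∀ v ∈ V, θ v = σ v) → θ x = c →
        ¬ ∀ A ∈ q, appA θ A ∈ r := by
      intro c
      by_contra hc
      push Not at hc
      have hcert : CertV S (insert x V) q db (Function.update σ x c) := by
        intro r hr
        obtain ⟨θ, h1, h2, h3⟩ := hc r hr
        refine ⟨θ, ?_, h3⟩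
        intro v hv
        rcases Finset.mem_insert.1 hv with rfl | hv
        · simpa using h2
        · have : v ≠ x := fun e => hxV (e ▸ hv)
          rw [Function.update_of_ne this]
          exact h1 v hv
      refine hno ⟨c, ?_, hcert⟩
      obtain ⟨r, hr, _⟩ := exists_repair S db ∅ (Finset.empty_subset _)
        (fun A hA => absurd hA (Finset.notMem_empty _))
      obtain ⟨θ, h1, h2⟩ := hcert r hr
      obtain ⟨F, hF⟩ := hne
      have := mem_adom_of_app (hr.1 (h2 F hF)) (keyVars_subset S F (hx F hF))
      rw [h1 x (Finset.mem_insert_self _ _), Function.update_self] at this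
      exact hD this
    choose ρ hρ hbad using hno'
    let κ : Atom → ℕ := fun A =>
      if h : ∃ c, ∃ F ∈ q, ∃ θ : ℕ → ℕ, θ x = c ∧ keyEqual S (appA θ F) A then h.choose else 0
    have hκ : ∀ A B, keyEqual S A B → κ A = κ B := by
      intro A B hAB
      have : ∀ F (θ : ℕ → ℕ), keyEqual S (appA θ F) A ↔ keyEqual S (appA θ F) B := by
        intro F θ
        exact ⟨fun h => keyEqual_trans h hAB, fun h => keyEqual_trans h (keyEqual_symm hAB)⟩
      simp only [κ, this]
    have hval : ∀ F ∈ q, ∀ θ : ℕ → ℕ, κ (appA θ F) = θ x := by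
      intro F hF θ
      have hex : ∃ c, ∃ G ∈ q, ∃ τ : ℕ → ℕ, τ x = c ∧ keyEqual S (appA τ G) (appA θ F) :=
        ⟨θ x, F, hF, θ, rfl, rfl, rfl⟩
      simp only [κ, dif_pos hex]
      obtain ⟨G, hG, τ, h1, h2⟩ := hex.choose_spec
      rw [← h1]
      have hGF : G = F := hn G hG F hF h2.1
      subst hGF
      have h3 := h2.2
      simp only [appA, ← List.map_take] at h3
      exact appL_eq h3 x (hx G hG)
    obtain ⟨θ, h1, h2⟩ := h _ (combine_repair S db ρ hρ κ hκ)
    refine hbad (θ x) θ h1 rfl ?_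
    intro A hA
    have := (Finset.mem_filter.1 (h2 A hA)).2
    rwa [hval A hA] at this
  · rintro ⟨a, _, h⟩ r hr
    obtain ⟨θ, h1, h2⟩ := h r hr
    refine ⟨θ, ?_, h2⟩
    intro v hv
    have : v ≠ x := fun e => hxV (e ▸ hv)
    rw [h1 v (Finset.mem_insert_of_mem hv), Function.update_of_ne this]

theorem CertV_peel (S : Schema) (V : Finset ℕ) (q db : Finset Atom) (σ : ℕ → ℕ) (F : Atom)
    (hF : F ∈ q) (hk : keyVars S F ⊆ V) (hn : NoSelfJoin q) :
    CertV S V q db σ ↔ (∃ A ∈ db, keyEqual S (appA σ F) A) ∧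
      ∀ A ∈ db, keyEqual S (appA σ F) A → ∃ θ : ℕ → ℕ, (∀ v ∈ V, θ v = σ v) ∧
        appA θ F = A ∧ CertV S (V ∪ varsA F) (q.erase F) db θ := by
  have hkey : ∀ θ : ℕ → ℕ, (∀ v ∈ V, θ v = σ v) → keyEqual S (appA σ F) (appA θ F) := by
    intro θ hθ
    refine ⟨rfl, ?_⟩
    simp only [appA, ← List.map_take]
    exact appL_congr (fun v hv => (hθ v (hk hv)).symm)
  constructor
  · intro h
    constructor
    · obtain ⟨r, hr, _⟩ := exists_repair S db ∅ (Finset.empty_subset _)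
        (fun A hA => absurd hA (Finset.notMem_empty _))
      obtain ⟨θ, h1, h2⟩ := h r hr
      exact ⟨_, hr.1 (h2 F hF), hkey θ h1⟩
    · intro A hA hAk
      obtain ⟨r, hr, hAr⟩ := exists_repair S db {A} (Finset.singleton_subset_iff.2 hA)
        (by
          intro B hB C hC _
          rw [Finset.mem_singleton.1 hB, Finset.mem_singleton.1 hC])
      have hAr : A ∈ r := hAr (Finset.mem_singleton_self A)
      obtain ⟨θ, h1, h2⟩ := h r hr
      have hθ : appA θ F = A := hr.2.1 _ (h2 F hF) _ hAr
        (keyEqual_trans (keyEqual_symm (hkey θ h1)) hAk)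
      refine ⟨θ, h1, hθ, ?_⟩
      intro r' hr'
      have hcomb := combine_repair S db (fun n => if n = 0 then r' else r)
        (by intro c; split_ifs <;> assumption)
        (fun B => if keyEqual S A B then 1 else 0)
        (by
          intro B C hBC
          have : keyEqual S A B ↔ keyEqual S A C :=
            ⟨fun h => keyEqual_trans h hBC, fun h => keyEqual_trans h (keyEqual_symm hBC)⟩
          simp only [this])
      obtain ⟨τ, h3, h4⟩ := h _ hcomb
      have hAτ : keyEqual S A (appA τ F) :=
        keyEqual_trans (keyEqual_symm hAk) (hkey τ h3)
      have hτF := (Finset.mem_filter.1 (h4 F hF)).2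
      simp only [hAτ, if_true, one_ne_zero, if_false] at hτF
      have hτA : A = appA τ F := hr.2.1 _ hAr _ hτF hAτ
      refine ⟨τ, ?_, ?_⟩
      · intro v hv
        rcases Finset.mem_union.1 hv with hv | hv
        · rw [h3 v hv, h1 v hv]
        · exact appA_eq (hτA.symm.trans hθ.symm) v hv
      · intro G hG
        rw [Finset.mem_erase] at hG
        have hne : ¬ keyEqual S A (appA τ G) := by
          intro hh
          have : F.rel = G.rel := by
            have := hh.1
            rw [← hθ] at this
            exact this
          exact hG.1 (hn F hF G hG.2 this).symm
        have := (Finset.mem_filter.1 (h4 G hG.2)).2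
        simpa only [hne, if_false, if_true] using this
  · rintro ⟨⟨A, hA, hAk⟩, h⟩ r hr
    obtain ⟨B, hB, hAB⟩ := ((isRepair_iff S db r).1 hr).2.2 A hA
    obtain ⟨θ, h1, h2, h3⟩ := h B (hr.1 hB) (keyEqual_trans hAk hAB)
    obtain ⟨τ, h4, h5⟩ := h3 r hr
    refine ⟨τ, ?_, ?_⟩
    · intro v hv
      rw [h4 v (Finset.mem_union_left _ hv), h1 v hv]
    · intro G hG
      by_cases hGF : G = F
      · subst hGF
        rw [appA_congr (τ := θ) (fun v hv => h4 v (Finset.mem_union_right _ hv)), h2]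
        exact hB
      · exact h5 G (Finset.mem_erase.2 ⟨hGF, hG⟩)


/-- Iterated existential quantification. -/
def exs : List ℕ → Fml → Fml
  | [], φ => φ
  | v :: l, φ => .ex v (exs l φ)

theorem exs_holds (db : Finset Atom) (D : Finset ℕ) (φ : Fml) (l : List ℕ) :
    ∀ σ : ℕ → ℕ, Holds db D (exs l φ) σ ↔
      ∃ τ : ℕ → ℕ, (∀ v ∈ l, τ v ∈ D) ∧ (∀ v, v ∉ l → τ v = σ v) ∧ Holds db D φ τ := by
  induction l with
  | nil =>
    intro σ
    simp only [exs]
    constructor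
    · intro h
      exact ⟨σ, by simp, by simp, h⟩
    · rintro ⟨τ, _, h2, h3⟩
      have : τ = σ := funext fun v => h2 v (by simp)
      rwa [← this]
  | cons w l ih =>
    intro σ
    simp only [exs, Holds, ih]
    constructor
    · rintro ⟨a, ha, τ, h1, h2, h3⟩
      refine ⟨τ, ?_, ?_, h3⟩
      · intro v hv
        by_cases hvl : v ∈ l
        · exact h1 v hvl
        · have : v = w := by
            rcases List.mem_cons.1 hv with h | h
            · exact h
            · exact absurd h hvl
          subst this
          rw [h2 v hvl, Function.update_self]
          exact ha
      · intro v hv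
        rw [List.mem_cons, not_or] at hv
        rw [h2 v hv.2, Function.update_of_ne hv.1]
    · rintro ⟨τ, h1, h2, h3⟩
      refine ⟨τ w, h1 w (by simp), τ, fun v hv => h1 v (by simp [hv]), ?_, h3⟩
      intro v hv
      by_cases hvw : v = w
      · subst hvw
        simp
      · rw [Function.update_of_ne hvw]
        exact h2 v (by simp [hvw, hv])

theorem exs_free (φ : Fml) (l : List ℕ) : (exs l φ).free = φ.free \ l.toFinset := by
  induction l with
  | nil => simp [exs]
  | cons w l ih =>
    ext v
    simp only [exs, Fml.free, ih, Finset.mem_erase, Finset.mem_sdiff, List.toFinset_cons,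
      Finset.mem_insert]
    tauto

theorem exs_rels (φ : Fml) (l : List ℕ) : (exs l φ).rels = φ.rels := by
  induction l with
  | nil => rfl
  | cons w l ih => simpa [exs, Fml.rels] using ih

theorem exs_consts (φ : Fml) (l : List ℕ) : (exs l φ).consts = φ.consts := by
  induction l with
  | nil => rfl
  | cons w l ih => simpa [exs, Fml.consts] using ih

theorem exs_wf (S : Schema) (φ : Fml) (l : List ℕ) : FmlWf S (exs l φ) ↔ FmlWf S φ := by
  induction l with
  | nil => rfl
  | cons w l ih => simpa [exs, FmlWf] using ih

/-- Conjunction of componentwise equalities. -/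
def eqs : List Trm → List Trm → Fml
  | s :: l, t :: m => .and (.eq s t) (eqs l m)
  | _, _ => .tru

theorem eqs_holds (db : Finset Atom) (D : Finset ℕ) (σ : ℕ → ℕ) :
    ∀ l m : List Trm, l.length = m.length →
      (Holds db D (eqs l m) σ ↔ l.map (appT σ) = m.map (appT σ)) := by
  have happ : ∀ t, appT σ t = Sum.inr (evalT σ t) := by
    intro t
    rcases t with v | c <;> rfl
  intro l
  induction l with
  | nil =>
    intro m hm
    have : m = [] := List.length_eq_zero_iff.1 hm.symm
    subst this
    simp [eqs, Holds]
  | cons s l ih =>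
    intro m hm
    rcases m with _ | ⟨t, m⟩
    · simp at hm
    · have := ih m (by simpa using hm)
      simp only [eqs, Holds, this, List.map_cons, List.cons.injEq, happ, Sum.inr.injEq]

theorem eqs_free : ∀ l m : List Trm, (eqs l m).free ⊆ varsL l ∪ varsL m := by
  intro l
  induction l with
  | nil => intro m; simp [eqs, Fml.free]
  | cons s l ih =>
    intro m
    rcases m with _ | ⟨t, m⟩
    · simp [eqs, Fml.free]
    · intro v hv
      simp only [eqs, Fml.free, Finset.mem_union] at hv
      simp only [Finset.mem_union, mem_varsL, List.mem_cons]
      rcases hv with hv | hv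
      · simp only [mem_varsL, List.mem_cons, List.not_mem_nil, or_false] at hv
        tauto
      · have := ih m hv
        simp only [Finset.mem_union, mem_varsL] at this
        tauto

theorem eqs_consts : ∀ l m : List Trm, (eqs l m).consts ⊆ constsL l ∪ constsL m := by
  intro l
  induction l with
  | nil => intro m; simp [eqs, Fml.consts]
  | cons s l ih =>
    intro m
    rcases m with _ | ⟨t, m⟩
    · simp [eqs, Fml.consts]
    · intro v hv
      simp only [eqs, Fml.consts, Finset.mem_union] at hv
      simp only [Finset.mem_union, mem_constsL, List.mem_cons]
      rcases hv with hv | hv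
      · simp only [mem_constsL, List.mem_cons, List.not_mem_nil, or_false] at hv
        tauto
      · have := ih m hv
        simp only [Finset.mem_union, mem_constsL] at this
        tauto

theorem eqs_rels : ∀ l m : List Trm, (eqs l m).rels = ∅ := by
  intro l
  induction l with
  | nil => intro m; simp [eqs, Fml.rels]
  | cons s l ih =>
    intro m
    rcases m with _ | ⟨t, m⟩
    · simp [eqs, Fml.rels]
    · simp [eqs, Fml.rels, ih]

theorem eqs_wf (S : Schema) : ∀ l m : List Trm, FmlWf S (eqs l m) := by
  intro l
  induction l with
  | nil => intro m; simp [eqs, FmlWf]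
  | cons s l ih =>
    intro m
    rcases m with _ | ⟨t, m⟩
    · simp [eqs, FmlWf]
    · simp [eqs, FmlWf, ih]

theorem holds_atom (db : Finset Atom) (D : Finset ℕ) (R : ℕ) (l : List Trm) (σ : ℕ → ℕ) :
    Holds db D (.atom R l) σ ↔ (⟨R, l.map (appT σ)⟩ : Atom) ∈ db := by
  have : (fun t => (Sum.inr (evalT σ t) : Trm)) = appT σ := by
    funext t
    rcases t with v | c <;> rfl
  simp only [Holds, this]

/-- Fresh variables. -/
def zvars (N m : ℕ) : List ℕ := (List.range m).map (N + ·)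

/-- Fresh variables as terms. -/
def zterms (N m : ℕ) : List Trm := (List.range m).map (fun i => Sum.inl (N + i))

/-- The formula for the peeling rule. -/
def peelFml (R : ℕ) (K T : List Trm) (N : ℕ) (ys : List ℕ) (φ : Fml) : Fml :=
  .and (exs (zvars N T.length) (.atom R (K ++ zterms N T.length)))
    (.not (exs (zvars N T.length) (.and (.atom R (K ++ zterms N T.length))
      (.not (exs ys (.and (eqs T (zterms N T.length)) φ))))))

theorem mem_zvars {N m v : ℕ} : v ∈ zvars N m ↔ N ≤ v ∧ v < N + m := by
  simp only [zvars, List.mem_map, List.mem_range]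
  constructor
  · rintro ⟨i, hi, rfl⟩
    omega
  · rintro ⟨h1, h2⟩
    exact ⟨v - N, by omega, by omega⟩

theorem mem_varsL_zterms {N m v : ℕ} : v ∈ varsL (zterms N m) ↔ v ∈ zvars N m := by
  simp [mem_varsL, zterms, zvars]

theorem constsL_zterms (N m : ℕ) : constsL (zterms N m) = ∅ := by
  ext c
  simp [mem_constsL, zterms]

theorem zterms_realize (N : ℕ) (w : List Trm) (hw : ∀ t ∈ w, ∃ c : ℕ, t = Sum.inr c)
    (σ : ℕ → ℕ) : ∃ τ : ℕ → ℕ, (∀ v, v ∉ zvars N w.length → τ v = σ v) ∧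
      (zterms N w.length).map (appT τ) = w := by
  refine ⟨fun v => if h : N ≤ v ∧ v < N + w.length then
    (hw (w[v - N]'(by omega)) (List.getElem_mem _)).choose else σ v, ?_, ?_⟩
  · intro v hv
    rw [mem_zvars] at hv
    simp only [dif_neg hv]
  · refine List.ext_getElem (by simp [zterms]) ?_
    intro i h1 h2
    have h3 : N ≤ N + i ∧ N + i < N + w.length := by omega
    simp only [zterms, List.getElem_map, List.getElem_range, appT, dif_pos h3]
    have h4 := (hw (w[N + i - N]'(by omega)) (List.getElem_mem _)).choose_spec
    rw [← h4]
    simp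

theorem peel_holds (S : Schema) (V : Finset ℕ) (q : Finset Atom) (F : Atom)
    (hwf : wfAtom S F) (hk : keyVars S F ⊆ V) (N : ℕ) (hN : ∀ v ∈ V ∪ varsA F, v < N)
    (φ : Fml) (db : Finset Atom) (hdb : IsDb S db) (D : Finset ℕ) (hD : adom db ⊆ D)
    (hφ : ∀ σ, CertV S (V ∪ varsA F) q db σ ↔ Holds db D φ σ) (σ : ℕ → ℕ) :
    ((∃ A ∈ db, keyEqual S (appA σ F) A) ∧
      ∀ A ∈ db, keyEqual S (appA σ F) A → ∃ θ : ℕ → ℕ, (∀ v ∈ V, θ v = σ v) ∧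
        appA θ F = A ∧ CertV S (V ∪ varsA F) q db θ) ↔
    Holds db D (peelFml F.rel (F.args.take (S.keyLen F.rel)) (F.args.drop (S.keyLen F.rel)) N
      (varsA F \ V).toList φ) σ := by
  set K := F.args.take (S.keyLen F.rel) with hK
  set T := F.args.drop (S.keyLen F.rel) with hT
  have hKT : K ++ T = F.args := List.take_append_drop _ _
  have hKlen : K.length = S.keyLen F.rel := by
    rw [hK, List.length_take, hwf]
    exact min_eq_left (S.keyLen_le_arity _)
  have hTvars : varsL T ⊆ varsA F := by
    intro v hv
    rw [mem_varsL] at hv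
    exact mem_varsL.2 (List.mem_of_mem_drop hv)
  have hz : ∀ v ∈ V ∪ varsA F, v ∉ zvars N T.length := by
    intro v hv hv'
    have := hN v hv
    rw [mem_zvars] at hv'
    omega
  have hzV : ∀ v ∈ V, v ∉ zvars N T.length := fun v hv => hz v (Finset.mem_union_left _ hv)
  have fact1 : ∀ τ : ℕ → ℕ, (∀ v, v ∉ zvars N T.length → τ v = σ v) →
      keyEqual S (appA σ F) ⟨F.rel, (K ++ zterms N T.length).map (appT τ)⟩ := by
    intro τ hτ
    refine ⟨rfl, ?_⟩
    simp only [appA, ← List.map_take]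
    rw [List.take_append_of_le_length hKlen.ge, ← hK, List.take_of_length_le hKlen.le]
    exact appL_congr (fun v hv => (hτ v (hzV v (hk hv))).symm)
  have fact2 : ∀ A ∈ db, keyEqual S (appA σ F) A → ∃ τ : ℕ → ℕ,
      (∀ v ∈ zvars N T.length, τ v ∈ D) ∧ (∀ v, v ∉ zvars N T.length → τ v = σ v) ∧
      A = ⟨F.rel, (K ++ zterms N T.length).map (appT τ)⟩ := by
    intro A hA hAk
    obtain ⟨hf, hAw⟩ := hdb A hA
    have hrel : F.rel = A.rel := hAk.1
    have hlen : (A.args.drop (S.keyLen F.rel)).length = T.length := by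
      rw [hT, List.length_drop, List.length_drop, hAw, hwf, hrel]
    obtain ⟨τ, h1, h2⟩ := zterms_realize N (A.args.drop (S.keyLen F.rel))
      (fun t ht => hf t (List.mem_of_mem_drop ht)) σ
    rw [hlen] at h1 h2
    have hAeq : A = ⟨F.rel, (K ++ zterms N T.length).map (appT τ)⟩ := by
      have h3 := hAk.2
      simp only [appA, ← List.map_take] at h3
      rw [← hK, ← hrel] at h3
      have h4 : K.map (appT τ) = K.map (appT σ) :=
        appL_congr (fun v hv => h1 v (hzV v (hk hv)))
      rw [List.map_append, h2, h4, h3, List.take_append_drop, hrel]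
    refine ⟨τ, ?_, h1, hAeq⟩
    intro v hv
    have : appA τ ⟨F.rel, K ++ zterms N T.length⟩ ∈ db := by
      rw [hAeq] at hA
      exact hA
    refine hD (mem_adom_of_app this ?_)
    rw [varsA, mem_varsL, List.mem_append]
    exact Or.inr (mem_varsL.1 (mem_varsL_zterms.2 hv))
  have hlenz : T.length = (zterms N T.length).length := by simp [zterms]
  simp only [peelFml, Holds, exs_holds, eqs_holds _ _ _ T (zterms N T.length) hlenz]
  simp only [← hφ]
  refine and_congr ?_ ?_
  · constructor
    · rintro ⟨A, hA, hAk⟩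
      obtain ⟨τ, h1, h2, h3⟩ := fact2 A hA hAk
      refine ⟨τ, h1, h2, ?_⟩
      have := (holds_atom db D F.rel (K ++ zterms N T.length) τ).2 (h3 ▸ hA)
      exact this
    · rintro ⟨τ, h1, h2, h3⟩
      have := (holds_atom db D F.rel (K ++ zterms N T.length) τ).1 h3
      exact ⟨_, this, fact1 τ h2⟩
  · rw [not_exists]
    constructor
    · rintro h τ ⟨h1, h2, h3, h4⟩
      have h3 := (holds_atom db D F.rel (K ++ zterms N T.length) τ).1 h3
      obtain ⟨θ, h5, h6, h7⟩ := h _ h3 (fact1 τ h2)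
      apply h4
      refine ⟨fun v => if v ∈ varsA F \ V then θ v else τ v, ?_, ?_, ?_, ?_⟩
      · intro v hv
        rw [Finset.mem_toList] at hv
        simp only [if_pos hv]
        rw [← h6] at h3
        exact hD (mem_adom_of_app h3 (Finset.mem_sdiff.1 hv).1)
      · intro v hv
        rw [Finset.mem_toList] at hv
        simp only [if_neg hv]
      · have e1 : T.map (appT fun v => if v ∈ varsA F \ V then θ v else τ v)
            = T.map (appT θ) := by
          refine appL_congr fun v hv => ?_
          split_ifs with hv'
          · rfl
          · have hvV : v ∈ V := by
              by_contra hh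
              exact hv' (Finset.mem_sdiff.2 ⟨hTvars hv, hh⟩)
            rw [h2 v (hzV v hvV), h5 v hvV]
        have e2 : (zterms N T.length).map (appT fun v => if v ∈ varsA F \ V then θ v else τ v)
            = (zterms N T.length).map (appT τ) := by
          refine appL_congr fun v hv => ?_
          rw [if_neg]
          intro hv'
          exact hz v (Finset.mem_union_right _ (Finset.mem_sdiff.1 hv').1)
            (mem_varsL_zterms.1 hv)
        rw [e1, e2]
        simp only [appA, Atom.mk.injEq, true_and] at h6
        rw [← hKT, List.map_append, List.map_append] at h6
        exact (List.append_inj h6 (by simp)).2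
      · refine (CertV_congr ?_).1 h7
        intro v hv
        split_ifs with hv'
        · rfl
        · have hvV : v ∈ V := by
            rcases Finset.mem_union.1 hv with h | h
            · exact h
            · by_contra hh
              exact hv' (Finset.mem_sdiff.2 ⟨h, hh⟩)
          rw [h2 v (hzV v hvV), h5 v hvV]
    · intro h A hA hAk
      obtain ⟨τ, h1, h2, h3⟩ := fact2 A hA hAk
      by_contra hno
      refine h τ ⟨h1, h2, ?_, ?_⟩
      · exact (holds_atom db D F.rel (K ++ zterms N T.length) τ).2 (h3 ▸ hA)
      · rintro ⟨ρ, h4, h5, h6, h7⟩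
        simp only [Finset.mem_toList] at h5
        have hρV : ∀ v ∈ V, ρ v = σ v := by
          intro v hv
          rw [h5 v (fun hh => (Finset.mem_sdiff.1 hh).2 hv), h2 v (hzV v hv)]
        refine hno ⟨ρ, hρV, ?_, h7⟩
        rw [h3]
        simp only [appA, Atom.mk.injEq, true_and]
        rw [← hKT, List.map_append, List.map_append, h6]
        congr 1
        · refine appL_congr fun v hv => ?_
          rw [hρV v (hk hv), h2 v (hzV v (hk hv))]
        · refine appL_congr fun v hv => ?_
          refine h5 v fun hh => ?_
          exact hz v (Finset.mem_union_right _ (Finset.mem_sdiff.1 hh).1)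
            (mem_varsL_zterms.1 hv)

theorem constsQ_mono {p q : Finset Atom} (h : p ⊆ q) : constsQ p ⊆ constsQ q :=
  Finset.biUnion_subset_biUnion_of_subset_left _ h

theorem NoSelfJoin.mono {p q : Finset Atom} (h : p ⊆ q) (hq : NoSelfJoin q) : NoSelfJoin p :=
  fun F hF G hG => hq F (h hF) G (h hG)

theorem safeX_formula (S : Schema) (V : Finset ℕ) (q : Finset Atom) (h : SafeX S V q) :
    (∀ F ∈ q, wfAtom S F) → NoSelfJoin q →
    ∃ φ : Fml, FmlWf S φ ∧ φ.free ⊆ V ∧ φ.rels ⊆ q.image Atom.rel ∧ φ.consts ⊆ constsQ q ∧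
      ∀ db : Finset Atom, IsDb S db → ∀ D : Finset ℕ, adom db ⊆ D → ∀ σ : ℕ → ℕ,
        (CertV S V q db σ ↔ Holds db D φ σ) := by
  induction h with
  | empty V =>
    intro _ _
    refine ⟨.tru, trivial, by simp [Fml.free], by simp [Fml.rels], by simp [Fml.consts], ?_⟩
    intro db _ D _ σ
    simp only [Holds, iff_true]
    intro r _
    exact ⟨σ, fun _ _ => rfl, fun A hA => absurd hA (Finset.notMem_empty _)⟩
  | split V q₁ q₂ hd _ _ ih1 ih2 =>
    intro hwf hn
    have s1 : q₁ ⊆ q₁ ∪ q₂ := Finset.subset_union_left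
    have s2 : q₂ ⊆ q₁ ∪ q₂ := Finset.subset_union_right
    obtain ⟨φ, a1, a2, a3, a4, a5⟩ := ih1 (fun F hF => hwf F (s1 hF)) (hn.mono s1)
    obtain ⟨ψ, b1, b2, b3, b4, b5⟩ := ih2 (fun F hF => hwf F (s2 hF)) (hn.mono s2)
    refine ⟨.and φ ψ, ⟨a1, b1⟩, Finset.union_subset a2 b2,
      Finset.union_subset (a3.trans (Finset.image_subset_image s1))
        (b3.trans (Finset.image_subset_image s2)),
      Finset.union_subset (a4.trans (constsQ_mono s1)) (b4.trans (constsQ_mono s2)), ?_⟩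
    intro db hdb D hD σ
    rw [CertV_split S V q₁ q₂ db σ hd, a5 db hdb D hD, b5 db hdb D hD]
    rfl
  | key V q x hxV hne hx _ ih =>
    intro hwf hn
    obtain ⟨φ, a1, a2, a3, a4, a5⟩ := ih hwf hn
    refine ⟨.ex x φ, a1, ?_, a3, a4, ?_⟩
    · intro v hv
      have hv := Finset.mem_erase.1 hv
      exact (Finset.mem_insert.1 (a2 hv.2)).resolve_left hv.1
    · intro db hdb D hD σ
      rw [CertV_key S V q db σ x hxV hne hx hn D hD]
      simp only [a5 db hdb D hD, Holds]
  | peel V q F hF hk _ ih =>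
    intro hwf hn
    have s1 : q.erase F ⊆ q := Finset.erase_subset _ _
    obtain ⟨φ, a1, a2, a3, a4, a5⟩ := ih (fun F hF => hwf F (s1 hF)) (hn.mono s1)
    obtain ⟨N, hN⟩ : ∃ N : ℕ, ∀ v ∈ V ∪ varsA F, v < N :=
      ⟨(V ∪ varsA F).sup id + 1, fun v hv => Nat.lt_succ_of_le (Finset.le_sup (f := id) hv)⟩
    have hT : ∀ t ∈ F.args.drop (S.keyLen F.rel), t ∈ F.args :=
      fun t ht => List.mem_of_mem_drop ht
    have hKm : ∀ t ∈ F.args.take (S.keyLen F.rel), t ∈ F.args :=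
      fun t ht => List.mem_of_mem_take ht
    have hlen : (F.args.take (S.keyLen F.rel)
        ++ zterms N (F.args.drop (S.keyLen F.rel)).length).length = S.arity F.rel := by
      have h1 : F.args.length = S.arity F.rel := hwf F hF
      have h2 := S.keyLen_le_arity F.rel
      simp only [List.length_append, List.length_take, zterms, List.length_map,
        List.length_range, List.length_drop]
      omega
    have hconsts : ∀ c, (Sum.inr c : Trm) ∈ F.args → c ∈ constsQ q := by
      intro c hc
      rw [constsQ, Finset.mem_biUnion]
      exact ⟨F, hF, mem_constsL.2 hc⟩
    have hatomC : constsL (F.args.take (S.keyLen F.rel)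
        ++ zterms N (F.args.drop (S.keyLen F.rel)).length) ⊆ constsQ q := by
      intro c hc
      rw [mem_constsL, List.mem_append] at hc
      rcases hc with hc | hc
      · exact hconsts c (hKm _ hc)
      · rw [← mem_constsL, constsL_zterms] at hc
        simp at hc
    have hatomV : ∀ v ∈ varsL (F.args.take (S.keyLen F.rel)
        ++ zterms N (F.args.drop (S.keyLen F.rel)).length),
        v ∈ V ∨ v ∈ zvars N (F.args.drop (S.keyLen F.rel)).length := by
      intro v hv
      rw [mem_varsL, List.mem_append] at hv
      rcases hv with hv | hv
      · exact Or.inl (hk (mem_varsL.2 hv))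
      · exact Or.inr (mem_varsL_zterms.1 (mem_varsL.2 hv))
    refine ⟨peelFml F.rel (F.args.take (S.keyLen F.rel)) (F.args.drop (S.keyLen F.rel)) N
      (varsA F \ V).toList φ, ?_, ?_, ?_, ?_, ?_⟩
    · simp only [peelFml, FmlWf, exs_wf, eqs_wf]
      exact ⟨hlen, hlen, trivial, a1⟩
    · intro v hv
      simp only [peelFml, Fml.free, exs_free, Finset.mem_union, Finset.mem_sdiff,
        List.mem_toFinset, Finset.mem_toList] at hv
      rcases hv with ⟨h1, h2⟩ | ⟨h1 | ⟨h1, h3⟩, h2⟩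
      · exact (hatomV v h1).resolve_right h2
      · exact (hatomV v h1).resolve_right h2
      · by_contra hvV
        have hvF : v ∉ varsA F := fun hh => h3 ⟨hh, hvV⟩
        rcases h1 with h1 | h1
        · rcases Finset.mem_union.1 (eqs_free _ _ h1) with h | h
          · exact hvF (mem_varsL.2 (hT _ (mem_varsL.1 h)))
          · exact h2 (mem_varsL_zterms.1 h)
        · rcases Finset.mem_union.1 (a2 h1) with h | h
          · exact hvV h
          · exact hvF h
    · intro R hR
      simp only [peelFml, Fml.rels, exs_rels, eqs_rels, Finset.mem_union,
        Finset.mem_singleton, Finset.notMem_empty, false_or] at hR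
      rcases hR with rfl | rfl | hR
      · exact Finset.mem_image_of_mem _ hF
      · exact Finset.mem_image_of_mem _ hF
      · exact Finset.image_subset_image s1 (a3 hR)
    · intro c hc
      simp only [peelFml, Fml.consts, exs_consts, Finset.mem_union] at hc
      rcases hc with hc | hc | hc | hc
      · exact hatomC hc
      · exact hatomC hc
      · rcases Finset.mem_union.1 (eqs_consts _ _ hc) with h | h
        · exact hconsts c (hT _ (mem_constsL.1 h))
        · rw [constsL_zterms] at h
          simp at h
      · exact constsQ_mono s1 (a4 hc)
    · intro db hdb D hD σ
      rw [CertV_peel S V q db σ F hF hk hn]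
      exact peel_holds S V (q.erase F) F (hwf F hF) hk N hN φ db hdb D hD
        (fun σ => a5 db hdb D hD σ) σ

end AuxProofs

/-- If a self-join-free Boolean conjunctive query `q` is safe,
then `CERTAINTY(q)` is first-order expressible: there is a first-order sentence
over the relation names and constants of `q` that holds in (the structure
given by) `db`, with quantifiers ranging over the active domain of `db`
together with the constants of `q`, iff `db ∈ CERTAINTY(q)`. -/
theorem statement15 (S : Schema) (q : Finset Atom) (hq : ∀ F ∈ q, wfAtom S F)
    (hnsj : NoSelfJoin q) (hsafe : Safe S q) :
    ∃ φ : Fml, FmlWf S φ ∧ φ.free = ∅ ∧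
      φ.rels ⊆ q.image Atom.rel ∧ φ.consts ⊆ constsQ q ∧
      ∀ db : Finset Atom, IsDb S db → ∀ σ : ℕ → ℕ,
        (Certainty S q db ↔ Holds db (adom db ∪ constsQ q) φ σ) := by
  obtain ⟨φ, a1, a2, a3, a4, a5⟩ :=
    safeX_formula S ∅ q (safeX_of_safe S q hsafe) hq hnsj
  refine ⟨φ, a1, Finset.subset_empty.1 a2, a3, a4, ?_⟩
  intro db hdb σ
  rw [CertV_empty_iff S q db σ]
  exact a5 db hdb _ Finset.subset_union_left σ
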